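/- Let C_e be the unique real root of 31x³ − 62x² + 35x − 3 and C_m the unique real root of 31x³ − 31x² + 16x − 3. Then the probability that a uniformly random Dyck meander with catastrophes of length n is an excursion converges: lim_{n→∞} e_n / m_n = C_e / C_m (≈ 0.31767), where e_n counts Dyck paths with catastrophes of length n and m_n counts Dyck meanders with catastrophes of length n. -/

import Mathlib

open Filter Topology

/-- Validity of a path with catastrophes over the jump set `J`, starting from
altitude `h`: each step is either a jump `s ∈ J` keeping the altitude
nonnegative, or a catastrophe `s = -h` from an altitude `h > 0` with `-h ∉ J`
(landing at altitude `0`). -/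
def CatValidFrom (J : Finset ℤ) : ℤ → List ℤ → Prop
  | _, [] => True
  | h, s :: r =>
    ((s ∈ J ∧ 0 ≤ h + s) ∨ (s = -h ∧ 0 < h ∧ -h ∉ J)) ∧ CatValidFrom J (h + s) r

/-- The jump set of Dyck paths. For this jump set a catastrophe is a jump
`-h` from an altitude `h ≥ 2` to altitude `0`. -/
def dyckJ : Finset ℤ := {-1, 1}

/-- `l` is a Dyck meander with catastrophes of length `n` (endpoint at any
altitude). -/
def DyckCatMeander (n : ℕ) (l : List ℤ) : Prop :=
  l.length = n ∧ CatValidFrom dyckJ 0 l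

/-- The number `m n` of Dyck meanders with catastrophes of length `n`. -/
noncomputable def mCount (n : ℕ) : ℕ := Nat.card {l : List ℤ // DyckCatMeander n l}

/-- The number `e n` of Dyck paths with catastrophes of length `n`
(meanders ending at altitude `0`). -/
noncomputable def eCount (n : ℕ) : ℕ :=
  Nat.card {l : List ℤ // DyckCatMeander n l ∧ l.sum = 0}

/-- The number of Dyck paths with catastrophes of length `n` starting at altitude `h`, where a path
ending at altitude `k` is counted with weight `w k`. -/
def catCount (w : ℕ → ℕ) : ℕ → ℕ → ℕ
  | 0, h => w h
  | n + 1, 0 => catCount w n 1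
  | n + 1, 1 => catCount w n 2 + catCount w n 0
  | n + 1, h + 2 => catCount w n (h + 3) + catCount w n (h + 1) + catCount w n 0

/-- The Dyck paths with catastrophes of length `n` from altitude `h` to an altitude in `S`. -/
def catPaths (S : Set ℤ) (n : ℕ) (h : ℤ) : Set (List ℤ) :=
  {l | l.length = n ∧ CatValidFrom dyckJ h l ∧ h + l.sum ∈ S}

theorem cons_mem_catPaths {S : Set ℤ} {n : ℕ} {h s : ℤ} {l : List ℤ} :
    s :: l ∈ catPaths S (n + 1) h ↔
      (((s = -1 ∨ s = 1) ∧ 0 ≤ h + s) ∨ (s = -h ∧ 2 ≤ h)) ∧ l ∈ catPaths S n (h + s) := by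
  have key : (s = -h ∧ 0 < h ∧ -h ∉ dyckJ) ↔ (s = -h ∧ 2 ≤ h) := by
    simp only [dyckJ, Finset.mem_insert, Finset.mem_singleton]
    omega
  simp only [catPaths, Set.mem_ofPred_eq, List.length_cons, Nat.add_right_cancel_iff, CatValidFrom,
    List.sum_cons, key, add_assoc]
  simp only [dyckJ, Finset.mem_insert, Finset.mem_singleton]
  tauto

theorem nil_notMem_catPaths {S : Set ℤ} {n : ℕ} {h : ℤ} : [] ∉ catPaths S (n + 1) h := by
  simp [catPaths]

theorem catPaths_succ_zero (S : Set ℤ) (n : ℕ) :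
    catPaths S (n + 1) 0 = List.cons 1 '' catPaths S n 1 := by
  ext l
  rcases l with _ | ⟨s, l⟩
  · simp [nil_notMem_catPaths]
  · rw [cons_mem_catPaths]
    simp only [Set.mem_image, List.cons.injEq]
    constructor
    · rintro ⟨h, hl⟩
      obtain rfl : s = 1 := by omega
      exact ⟨l, by simpa using hl, rfl, rfl⟩
    · rintro ⟨l, hl, rfl, rfl⟩
      exact ⟨by norm_num, by simpa using hl⟩

theorem catPaths_succ_one (S : Set ℤ) (n : ℕ) :
    catPaths S (n + 1) 1 = List.cons 1 '' catPaths S n 2 ∪ List.cons (-1) '' catPaths S n 0 := by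
  ext l
  rcases l with _ | ⟨s, l⟩
  · simp [nil_notMem_catPaths]
  · rw [cons_mem_catPaths]
    simp only [Set.mem_union, Set.mem_image, List.cons.injEq]
    constructor
    · rintro ⟨h, hl⟩
      obtain rfl | rfl : s = 1 ∨ s = -1 := by omega
      · exact Or.inl ⟨l, by simpa using hl, rfl, rfl⟩
      · exact Or.inr ⟨l, by simpa using hl, rfl, rfl⟩
    · rintro (⟨l, hl, rfl, rfl⟩ | ⟨l, hl, rfl, rfl⟩)
      · exact ⟨by norm_num, by simpa using hl⟩
      · exact ⟨by norm_num, by simpa using hl⟩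

theorem catPaths_succ_of_two_le (S : Set ℤ) (n : ℕ) {h : ℤ} (hh : 2 ≤ h) :
    catPaths S (n + 1) h = List.cons 1 '' catPaths S n (h + 1) ∪
      List.cons (-1) '' catPaths S n (h - 1) ∪ List.cons (-h) '' catPaths S n 0 := by
  ext l
  rcases l with _ | ⟨s, l⟩
  · simp [nil_notMem_catPaths]
  · rw [cons_mem_catPaths]
    simp only [Set.mem_union, Set.mem_image, List.cons.injEq]
    constructor
    · rintro ⟨hs, hl⟩
      obtain rfl | rfl | rfl : s = 1 ∨ s = -1 ∨ s = -h := by omega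
      · exact Or.inl (Or.inl ⟨l, hl, rfl, rfl⟩)
      · exact Or.inl (Or.inr ⟨l, hl, rfl, rfl⟩)
      · exact Or.inr ⟨l, by simpa using hl, rfl, rfl⟩
    · rintro ((⟨l, hl, rfl, rfl⟩ | ⟨l, hl, rfl, rfl⟩) | ⟨l, hl, rfl, rfl⟩)
      · exact ⟨by omega, hl⟩
      · exact ⟨by omega, hl⟩
      · exact ⟨by omega, by simpa using hl⟩

theorem disjoint_image_cons {s t : ℤ} (hst : s ≠ t) (A B : Set (List ℤ)) :
    Disjoint (List.cons s '' A) (List.cons t '' B) := by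
  rw [Set.disjoint_left]
  rintro _ ⟨l, -, rfl⟩ ⟨l', -, h⟩
  exact hst (List.cons.inj h).1.symm

open Classical in
theorem finite_and_ncard_catPaths (S : Set ℤ) (n h : ℕ) :
    (catPaths S n h).Finite ∧
      (catPaths S n h).ncard = catCount (fun k => if (k : ℤ) ∈ S then 1 else 0) n h := by
  have hinj (s : ℤ) : Function.Injective (List.cons s) := List.cons_injective
  induction n generalizing h with
  | zero =>
    have hset : catPaths S 0 h = if (h : ℤ) ∈ S then {[]} else ∅ := by
      ext l
      split_ifs with hS <;> cases l <;> simp [catPaths, CatValidFrom, hS]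
    rw [hset, catCount]
    split_ifs <;> simp
  | succ n ih =>
    match h with
    | 0 =>
      obtain ⟨f1, c1⟩ := ih 1
      push_cast at f1 c1 ⊢
      rw [catPaths_succ_zero, Set.ncard_image_of_injective _ (hinj _), c1, catCount]
      exact ⟨f1.image _, rfl⟩
    | 1 =>
      obtain ⟨f0, c0⟩ := ih 0
      obtain ⟨f2, c2⟩ := ih 2
      push_cast at f0 c0 f2 c2 ⊢
      rw [catPaths_succ_one, Set.ncard_union_eq (disjoint_image_cons (by norm_num) _ _)
        (f2.image _) (f0.image _), Set.ncard_image_of_injective _ (hinj _),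
        Set.ncard_image_of_injective _ (hinj _), c0, c2, catCount]
      exact ⟨(f2.image _).union (f0.image _), rfl⟩
    | h + 2 =>
      obtain ⟨f0, c0⟩ := ih 0
      obtain ⟨f1, c1⟩ := ih (h + 1)
      obtain ⟨f3, c3⟩ := ih (h + 3)
      have e3 : ((h + 2 : ℕ) : ℤ) + 1 = (h + 3 : ℕ) := by push_cast; ring
      have e1 : ((h + 2 : ℕ) : ℤ) - 1 = (h + 1 : ℕ) := by push_cast; ring
      rw [Nat.cast_zero] at f0 c0
      rw [catPaths_succ_of_two_le S n (by omega), e1, e3, Set.ncard_union_eq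
        (Set.disjoint_union_left.2 ⟨disjoint_image_cons (by omega) _ _,
          disjoint_image_cons (by omega) _ _⟩)
        ((f3.image _).union (f1.image _)) (f0.image _),
        Set.ncard_union_eq (disjoint_image_cons (by norm_num) _ _) (f3.image _) (f1.image _),
        Set.ncard_image_of_injective _ (hinj _), Set.ncard_image_of_injective _ (hinj _),
        Set.ncard_image_of_injective _ (hinj _), c0, c1, c3, catCount]
      exact ⟨((f3.image _).union (f1.image _)).union (f0.image _), rfl⟩

/-- The number of Dyck paths with catastrophes of length `n` from altitude `h` to altitude `0`. -/
abbrev excursionCount : ℕ → ℕ → ℕ := catCount fun k => if k = 0 then 1 else 0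

theorem eCount_eq (n : ℕ) : eCount n = excursionCount n 0 := by
  have h := (finite_and_ncard_catPaths {0} n 0).2
  rw [← Nat.card_coe_set_eq] at h
  simp only [catPaths, Set.mem_singleton_iff, zero_add, Nat.cast_zero, Nat.cast_eq_zero] at h
  simpa only [eCount, DyckCatMeander, and_assoc] using! h

theorem mCount_eq (n : ℕ) : mCount n = catCount (fun _ => 1) n 0 := by
  have h := (finite_and_ncard_catPaths Set.univ n 0).2
  rw [← Nat.card_coe_set_eq] at h
  simp only [catPaths, Set.mem_univ, and_true, if_true, Nat.cast_zero] at h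
  simpa only [mCount, DyckCatMeander] using! h

theorem catCount_one_eq (n h : ℕ) :
    catCount (fun _ => 1) n h = excursionCount n h + excursionCount (n + 1) h := by
  induction n generalizing h with
  | zero =>
    match h with
    | 0 => rfl
    | 1 => rfl
    | h + 2 => simp [catCount]
  | succ n ih =>
    match h with
    | 0 => simp [catCount, ih]
    | 1 =>
      have e (m : ℕ) : excursionCount (m + 1) 1 = excursionCount m 2 + excursionCount m 0 := rfl
      rw [catCount, ih, ih, e n, e (n + 1)]
      ring
    | h + 2 =>
      have e (m : ℕ) : excursionCount (m + 1) (h + 2) =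
        excursionCount m (h + 3) + excursionCount m (h + 1) + excursionCount m 0 := rfl
      rw [catCount, ih, ih, ih, e n, e (n + 1)]
      ring

theorem mCount_eq_add (n : ℕ) : mCount n = eCount n + eCount (n + 1) := by
  rw [mCount_eq, eCount_eq, eCount_eq, catCount_one_eq]

namespace PowerSeries

/-- The generating function of Dyck paths killed at their first visit to altitude `-1`. -/
noncomputable def firstPassage : PowerSeries ℤ :=
  X * expand 2 two_ne_zero (map (Nat.castRingHom ℤ) catalanSeries)

theorem firstPassage_eq : firstPassage = X * (1 + firstPassage ^ 2) := by
  have h := congrArg (fun f => expand 2 two_ne_zero (map (Nat.castRingHom ℤ) f))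
    catalanSeries_sq_mul_X_add_one
  simp only [map_add, map_mul, map_pow, map_one, map_X, expand_X] at h
  unfold firstPassage
  linear_combination -X * h

theorem coeff_firstPassage_odd (k : ℕ) : coeff (2 * k + 1) firstPassage = catalan k := by
  rw [firstPassage, coeff_succ_X_mul, coeff_expand_mul]
  simp

theorem coeff_firstPassage_even (k : ℕ) : coeff (2 * k) firstPassage = 0 := by
  rcases k with _ | k
  · simp [firstPassage]
  · rw [show 2 * (k + 1) = (2 * k + 1) + 1 by ring, firstPassage, coeff_succ_X_mul,
      coeff_expand_of_not_dvd]
    omega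

/-- A system of power series obeying the first-step recursion of Dyck paths that are killed
upon leaving the nonnegative half-line, without source term, vanishes. -/
theorem eq_zero_of_first_step {R : Type*} [CommSemiring R] {G : ℕ → PowerSeries R}
    (h0 : G 0 = X * G 1)
    (hs : ∀ h, G (h + 1) = X * (G (h + 2) + G h)) (h : ℕ) : G h = 0 := by
  ext n
  induction n generalizing h with
  | zero =>
    cases h with
    | zero => rw [h0]; simp
    | succ h => rw [hs]; simp
  | succ n ih =>
    cases h with
    | zero => rw [h0, coeff_succ_X_mul, ih]; simp
    | succ h => rw [hs, coeff_succ_X_mul, map_add, ih, ih]; simp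

/-- The generating function of Dyck paths with catastrophes from altitude `h` to `0`. -/
noncomputable def excursionSeries (h : ℕ) : PowerSeries ℤ := mk fun n => (excursionCount n h : ℤ)

theorem excursionSeries_zero : excursionSeries 0 = 1 + X * excursionSeries 1 := by
  ext n
  rcases n with _ | n <;> simp [excursionSeries, coeff_succ_X_mul, catCount, coeff_one]

theorem excursionSeries_one :
    excursionSeries 1 = X * (excursionSeries 2 + excursionSeries 0) := by
  ext n
  rcases n with _ | n <;> simp [excursionSeries, coeff_succ_X_mul, catCount]

theorem excursionSeries_add_two (h : ℕ) : excursionSeries (h + 2) =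
    X * (excursionSeries (h + 3) + excursionSeries (h + 1) + excursionSeries 0) := by
  ext n
  rcases n with _ | n <;> simp [excursionSeries, coeff_succ_X_mul, catCount]

theorem excursionSeries_succ (h : ℕ) : (1 - 2 * X) * excursionSeries (h + 1) =
    X * (1 - firstPassage ^ (h + 1)) * excursionSeries 0 := by
  have hu := firstPassage_eq
  rw [← sub_eq_zero]
  refine eq_zero_of_first_step (G := fun h => (1 - 2 * X) * excursionSeries (h + 1) -
    X * (1 - firstPassage ^ (h + 1)) * excursionSeries 0) ?_ (fun h => ?_) h
  · linear_combination (1 - 2 * X) * excursionSeries_one + X * excursionSeries 0 * hu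
  · linear_combination (1 - 2 * X) * excursionSeries_add_two h +
      X * excursionSeries 0 * firstPassage ^ (h + 1) * hu

theorem excursionSeries_zero_eq : (1 - X - 2 * X ^ 2 - X ^ 3) * excursionSeries 0 =
    1 - X - X ^ 2 - X ^ 2 * firstPassage := by
  have hu := firstPassage_eq
  have h1 : (1 - 2 * X - X ^ 2 + X ^ 2 * firstPassage) * excursionSeries 0 = 1 - 2 * X := by
    linear_combination (1 - 2 * X) * excursionSeries_zero + X * excursionSeries_succ 0
  have h2 : (1 - 2 * X : PowerSeries ℤ) ≠ 0 := fun h => by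
    simpa using congrArg (coeff 0) h
  apply mul_left_cancel₀ h2
  linear_combination (1 - X - X ^ 2 - X ^ 2 * firstPassage) * h1 -
    X ^ 3 * excursionSeries 0 * hu

end PowerSeries

open PowerSeries in
theorem eCount_add_three (n : ℕ) : (eCount (n + 3) : ℤ) =
    eCount (n + 2) + 2 * eCount (n + 1) + eCount n - coeff (n + 1) firstPassage := by
  have h := congrArg (coeff (n + 3)) excursionSeries_zero_eq
  have e : (1 - X - 2 * X ^ 2 - X ^ 3) * excursionSeries 0 = excursionSeries 0 -
    X * excursionSeries 0 - X * (X * (excursionSeries 0 + excursionSeries 0)) -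
      X * (X * (X * excursionSeries 0)) := by ring
  have e' : (1 - X - X ^ 2 - X ^ 2 * firstPassage) =
    1 - X * 1 - X * (X * 1) - X * (X * firstPassage) := by ring
  rw [e, e'] at h
  simp only [map_sub, map_add, coeff_succ_X_mul, coeff_one, excursionSeries, coeff_mk] at h
  simp only [eCount_eq]
  norm_num at h
  linarith

theorem catalan_succ_le (k : ℕ) : catalan (k + 1) ≤ 4 * catalan k := by
  have h1 := succ_mul_catalan_eq_centralBinom k
  have h2 := succ_mul_catalan_eq_centralBinom (k + 1)
  have h3 := Nat.succ_mul_centralBinom_succ k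
  rw [← h1, ← h2] at h3
  have h4 : (k + 1) * ((k + 2) * catalan (k + 1)) ≤ (k + 1) * ((k + 2) * (4 * catalan k)) := by
    calc _ = 2 * (2 * k + 1) * ((k + 1) * catalan k) := h3
      _ ≤ _ := by nlinarith [Nat.zero_le (catalan k), Nat.zero_le (k * catalan k)]
  exact Nat.le_of_mul_le_mul_left (Nat.le_of_mul_le_mul_left h4 (by positivity)) (by positivity)

theorem catalan_add_two_le (k : ℕ) : catalan (k + 2) ≤ 2 * 4 ^ k := by
  induction k with
  | zero => simp [catalan_two]
  | succ k ih =>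
    have := catalan_succ_le (k + 2)
    rw [pow_succ, show k + 1 + 2 = k + 2 + 1 by ring]
    omega

open PowerSeries in
theorem coeff_firstPassage_nonneg (n : ℕ) : 0 ≤ coeff n firstPassage := by
  obtain ⟨k, rfl | rfl⟩ := Nat.even_or_odd' n
  · rw [coeff_firstPassage_even]
  · rw [coeff_firstPassage_odd]; positivity

open PowerSeries in
theorem coeff_firstPassage_add_five_le (n : ℕ) : coeff (n + 5) firstPassage ≤ 2 * 2 ^ n := by
  obtain ⟨k, rfl | rfl⟩ := Nat.even_or_odd' n
  · rw [show 2 * k + 5 = 2 * (k + 2) + 1 by ring, coeff_firstPassage_odd, pow_mul]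
    exact_mod_cast catalan_add_two_le k
  · rw [show 2 * k + 1 + 5 = 2 * (k + 3) by ring, coeff_firstPassage_even]
    positivity

open PowerSeries in
theorem coeff_firstPassage_succ_le (n : ℕ) : coeff (n + 1) firstPassage ≤ 2 ^ n := by
  match n with
  | 0 => simpa using (coeff_firstPassage_odd 0).le
  | 1 => simpa using (coeff_firstPassage_even 1).le.trans zero_le_two
  | 2 => simpa using (coeff_firstPassage_odd 1).le.trans (by simp)
  | 3 => simpa using (coeff_firstPassage_even 2).le.trans (by simp)
  | n + 4 =>
    refine (coeff_firstPassage_add_five_le n).trans ?_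
    rw [pow_add]
    have : (0 : ℤ) < 2 ^ n := by positivity
    linarith

theorem eCount_lower_bound (n : ℕ) :
    (21 / 10 : ℝ) ^ n / 10 + 2 * 2 ^ n ≤ eCount (n + 4) := by
  induction n using Nat.strong_induction_on with
  | _ n ih =>
    match n with
    | 0 => rw [eCount_eq, show excursionCount (0 + 4) 0 = 3 from rfl]; norm_num
    | 1 => rw [eCount_eq, show excursionCount (1 + 4) 0 = 5 from rfl]; norm_num
    | 2 => rw [eCount_eq, show excursionCount (2 + 4) 0 = 12 from rfl]; norm_num
    | n + 3 =>
      have h0 := ih n (by omega)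
      have h1 := ih (n + 1) (by omega)
      have h2 := ih (n + 2) (by omega)
      have hrec : (eCount (n + 3 + 4) : ℝ) = eCount (n + 2 + 4) + 2 * eCount (n + 1 + 4) +
          eCount (n + 4) - (PowerSeries.coeff (n + 5) PowerSeries.firstPassage : ℤ) := by
        exact_mod_cast eCount_add_three (n + 4)
      have hc : ((PowerSeries.coeff (n + 5) PowerSeries.firstPassage : ℤ) : ℝ) ≤ 2 * 2 ^ n := by
        exact_mod_cast coeff_firstPassage_add_five_le n
      have hr : (0 : ℝ) < (21 / 10) ^ n := by positivity
      simp only [pow_succ] at h1 h2 ⊢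
      linarith

theorem abs_eCount_succ_sub_le {r : ℝ} (hr : r ^ 3 - r ^ 2 - 2 * r - 1 = 0) (h1 : 2.1 < r)
    (h2 : r < 2.2) (n : ℕ) : |(eCount (n + 1) : ℝ) - r * eCount n| ≤ 3 * 2 ^ n := by
  induction n using Nat.strong_induction_on with
  | _ n ih =>
    match n with
    | 0 =>
      rw [eCount_eq, eCount_eq, show excursionCount (0 + 1) 0 = 0 from rfl,
        show excursionCount 0 0 = 1 from rfl, abs_le]
      constructor <;> norm_num at * <;> linarith
    | 1 =>
      rw [eCount_eq, eCount_eq, show excursionCount (1 + 1) 0 = 1 from rfl,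
        show excursionCount 1 0 = 0 from rfl]
      norm_num
    | n + 2 =>
      have hrec : (eCount (n + 3) : ℝ) = eCount (n + 2) + 2 * eCount (n + 1) +
          eCount n - (PowerSeries.coeff (n + 1) PowerSeries.firstPassage : ℤ) := by
        exact_mod_cast eCount_add_three n
      have hc : ((PowerSeries.coeff (n + 1) PowerSeries.firstPassage : ℤ) : ℝ) ≤ 2 ^ n := by
        exact_mod_cast coeff_firstPassage_succ_le n
      have hc0 : (0 : ℝ) ≤ (PowerSeries.coeff (n + 1) PowerSeries.firstPassage : ℤ) := by
        exact_mod_cast coeff_firstPassage_nonneg (n + 1)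
      have hp : (0 : ℝ) < 2 ^ n := by positivity
      have hfac : (eCount (n + 3) : ℝ) - r * eCount (n + 2) =
          -(r - 1) * (eCount (n + 2) - r * eCount (n + 1)) -
          (r ^ 2 - r - 2) * (eCount (n + 1) - r * eCount n) -
          (PowerSeries.coeff (n + 1) PowerSeries.firstPassage : ℤ) := by
        linear_combination hrec - eCount n * hr
      have b1 : |(r - 1) * ((eCount (n + 2) : ℝ) - r * eCount (n + 1))| ≤
          1.2 * (3 * 2 ^ (n + 1)) := by
        rw [abs_mul]
        gcongr
        · rw [abs_le]; constructor <;> norm_num at * <;> linarith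
        · exact ih (n + 1) (by omega)
      have b0 : |(r ^ 2 - r - 2) * ((eCount (n + 1) : ℝ) - r * eCount n)| ≤
          0.64 * (3 * 2 ^ n) := by
        rw [abs_mul]
        gcongr
        · rw [abs_le]; constructor <;> norm_num at * <;> nlinarith
        · exact ih n (by omega)
      rw [abs_le] at b0 b1
      rw [show n + 2 + 1 = n + 3 from rfl, hfac, abs_le]
      simp only [pow_succ] at b1 ⊢
      norm_num at b0 b1 ⊢
      constructor <;> linarith

theorem tendsto_eCount_succ_div {r : ℝ} (hr : r ^ 3 - r ^ 2 - 2 * r - 1 = 0) (h1 : 2.1 < r)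
    (h2 : r < 2.2) :
    Tendsto (fun n => (eCount (n + 1) : ℝ) / eCount n) atTop (𝓝 r) := by
  rw [← tendsto_add_atTop_iff_nat 4, tendsto_iff_norm_sub_tendsto_zero]
  have hgeom : Tendsto (fun n : ℕ => 480 * (20 / 21 : ℝ) ^ n) atTop (𝓝 0) := by
    simpa using (tendsto_pow_atTop_nhds_zero_of_lt_one (by norm_num)
      (by norm_num : (20 / 21 : ℝ) < 1)).const_mul 480
  refine squeeze_zero (fun _ => norm_nonneg _) (fun n => ?_) hgeom
  have hlow : (21 / 10 : ℝ) ^ n / 10 ≤ eCount (n + 4) :=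
    le_trans (by linarith [pow_pos (two_pos : (0 : ℝ) < 2) n]) (eCount_lower_bound n)
  have hpos : (0 : ℝ) < eCount (n + 4) := lt_of_lt_of_le (by positivity) hlow
  have hd := abs_eCount_succ_sub_le hr h1 h2 (n + 4)
  rw [Real.norm_eq_abs, div_sub' hpos.ne', abs_div, abs_of_pos hpos, div_le_iff₀ hpos,
    mul_comm (eCount (n + 4) : ℝ) r]
  calc _ ≤ 3 * 2 ^ (n + 4) := hd
    _ = 480 * (20 / 21 : ℝ) ^ n * ((21 / 10 : ℝ) ^ n / 10) := by
      rw [show (2 : ℝ) = 20 / 21 * (21 / 10) by norm_num, mul_pow, pow_add, pow_add]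
      ring
    _ ≤ _ := by gcongr

theorem exists_growth_rate : ∃ r : ℝ, r ^ 3 - r ^ 2 - 2 * r - 1 = 0 ∧ 2.14 < r ∧ r < 2.15 := by
  have hc : ContinuousOn (fun r : ℝ => r ^ 3 - r ^ 2 - 2 * r - 1) (Set.Icc 2.14 2.15) := by
    fun_prop
  obtain ⟨r, hr, h⟩ := intermediate_value_Ioo (by norm_num) hc
    (show (0 : ℝ) ∈ Set.Ioo _ _ by constructor <;> norm_num)
  exact ⟨r, h, hr.1, hr.2⟩

theorem excursion_constant_eq {r x : ℝ} (hr : r ^ 3 - r ^ 2 - 2 * r - 1 = 0) (h1 : 2.14 < r)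
    (h2 : r < 2.15) (hx : 31 * x ^ 3 - 62 * x ^ 2 + 35 * x - 3 = 0) :
    x = (34 + 5 * r - 9 * r ^ 2) / 31 := by
  obtain ⟨y, hy⟩ : ∃ y, y = (34 + 5 * r - 9 * r ^ 2) / 31 := ⟨_, rfl⟩
  have hroot : 31 * y ^ 3 - 62 * y ^ 2 + 35 * y - 3 = 0 := by
    rw [hy]
    linear_combination (-729 / 961 * r ^ 3 + 486 / 961 * r ^ 2 + 1593 / 961 * r - 1639 / 961) * hr
  have hy1 : y < 0.13 := by rw [hy]; norm_num at *; nlinarith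
  have hquad : 0 < 31 * (x ^ 2 + x * y + y ^ 2) - 62 * (x + y) + 35 := by
    norm_num at hy1
    nlinarith [sq_nonneg (62 * x + 31 * y - 62), sq_nonneg y]
  have hmul : (x - y) * (31 * (x ^ 2 + x * y + y ^ 2) - 62 * (x + y) + 35) = 0 := by
    linear_combination hx - hroot
  rw [← hy]
  exact sub_eq_zero.1 ((mul_eq_zero.1 hmul).resolve_right hquad.ne')

theorem meander_constant_eq {r x : ℝ} (hr : r ^ 3 - r ^ 2 - 2 * r - 1 = 0)
    (hx : 31 * x ^ 3 - 31 * x ^ 2 + 16 * x - 3 = 0) :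
    x = (25 + 21 * r - 13 * r ^ 2) / 31 := by
  obtain ⟨y, hy⟩ : ∃ y, y = (25 + 21 * r - 13 * r ^ 2) / 31 := ⟨_, rfl⟩
  have hroot : 31 * y ^ 3 - 31 * y ^ 2 + 16 * y - 3 = 0 := by
    rw [hy]
    linear_combination (-2197 / 961 * r ^ 3 + 8450 / 961 * r ^ 2 - 5707 / 961 * r - 5767 / 961) * hr
  have hquad : 0 < 31 * (x ^ 2 + x * y + y ^ 2) - 31 * (x + y) + 16 := by
    nlinarith [sq_nonneg (62 * x + 31 * y - 31), sq_nonneg (3 * y - 1)]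
  have hmul : (x - y) * (31 * (x ^ 2 + x * y + y ^ 2) - 31 * (x + y) + 16) = 0 := by
    linear_combination hx - hroot
  rw [← hy]
  exact sub_eq_zero.1 ((mul_eq_zero.1 hmul).resolve_right hquad.ne')

/-- **Ratio of excursions among meanders.** If `Cₑ` is the (unique) real root
of `31x³ - 62x² + 35x - 3` and `Cₘ` the (unique) real root of
`31x³ - 31x² + 16x - 3`, then `e_n / m_n → Cₑ / Cₘ ≈ 0.31767`. -/
theorem eCount_div_mCount (Ce Cm : ℝ)
    (hCe : 31 * Ce ^ 3 - 62 * Ce ^ 2 + 35 * Ce - 3 = 0)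
    (hCm : 31 * Cm ^ 3 - 31 * Cm ^ 2 + 16 * Cm - 3 = 0) :
    Tendsto (fun n : ℕ => (eCount n : ℝ) / (mCount n : ℝ)) atTop (𝓝 (Ce / Cm)) := by
  obtain ⟨r, hr, h1, h2⟩ := exists_growth_rate
  have hr1 : 2.1 < r := lt_trans (by norm_num) h1
  have hr2 : r < 2.2 := lt_trans h2 (by norm_num)
  have hr0 : 1 + r ≠ 0 := by norm_num at h1; linarith
  have hCm0 : Cm ≠ 0 := by
    rintro rfl
    norm_num at hCm
  have hratio : Ce / Cm = (1 + r)⁻¹ := by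
    rw [← one_div, div_eq_div_iff hCm0 hr0, excursion_constant_eq hr h1 h2 hCe,
      meander_constant_eq hr hCm]
    linear_combination (-9 / 31) * hr
  rw [hratio]
  refine (((tendsto_eCount_succ_div hr hr1 hr2).const_add 1).inv₀ hr0).congr' ?_
  filter_upwards [eventually_ge_atTop 4] with n hn
  obtain ⟨k, rfl⟩ := Nat.exists_eq_add_of_le' hn
  have hpos : (0 : ℝ) < eCount (k + 4) := lt_of_lt_of_le (by positivity) (eCount_lower_bound k)
  rw [mCount_eq_add, Nat.cast_add, one_add_div hpos.ne', inv_div]
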